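/- If A is invertible and the system is controllable, i.e., the controllability matrix P_n = [B, AB, …, A^{n−1}B] has rank n, then for all positive integers N₁, N₂ with N₂ ≥ N₁ + n, the region R(N₁) is contained in the interior of R(N₂); consequently the boundaries are disjoint: (frontier of R(N₁)) ∩ (frontier of R(N₂)) = ∅. -/

import Mathlib

open Matrix

/-- The controllability (reachability) region after `N` steps of the linear discrete-time
system `x_{k+1} = A x_k + B u_k` under the unit input constraint `‖u_k‖_∞ ≤ 1`. -/
def reachRegion {n r : ℕ} (A : Matrix (Fin n) (Fin n) ℝ) (B : Matrix (Fin n) (Fin r) ℝ)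
    (N : ℕ) : Set (Fin n → ℝ) :=
  {x | ∃ z : Fin N → Fin r → ℝ, (∀ k, ‖z k‖ ≤ 1) ∧
    x = ∑ k : Fin N, (A ^ (k : ℕ)) *ᵥ (B *ᵥ z k)}

/-- The controllability matrix `P_N = [B, AB, …, A^{N−1}B]`. -/
def ctrbMatrix {n r : ℕ} (A : Matrix (Fin n) (Fin n) ℝ) (B : Matrix (Fin n) (Fin r) ℝ)
    (N : ℕ) : Matrix (Fin n) (Fin N × Fin r) ℝ :=
  fun i p => ((A ^ (p.1 : ℕ)) * B) i p.2

theorem isCompact_reachRegion {n r : ℕ} (A : Matrix (Fin n) (Fin n) ℝ)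
    (B : Matrix (Fin n) (Fin r) ℝ) (N : ℕ) : IsCompact (reachRegion A B N) := by
  have himage : reachRegion A B N =
      (fun z : Fin N → Fin r → ℝ => ∑ k : Fin N, (A ^ (k : ℕ)) *ᵥ (B *ᵥ z k)) ''
        Set.univ.pi fun _ => Metric.closedBall 0 1 := by
    ext x
    simp [reachRegion, Set.mem_pi, eq_comm]
  rw [himage]
  exact (isCompact_univ_pi fun _ => isCompact_closedBall _ _).image (by fun_prop)

theorem zero_mem_reachRegion {n r : ℕ} (A : Matrix (Fin n) (Fin n) ℝ)
    (B : Matrix (Fin n) (Fin r) ℝ) (N : ℕ) : 0 ∈ reachRegion A B N :=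
  ⟨0, by simp, by simp⟩

/-- Steering for `M` further steps adds the image under `A ^ N` of a point of `R(M)`. -/
theorem add_pow_mulVec_mem_reachRegion {n r : ℕ} {A : Matrix (Fin n) (Fin n) ℝ}
    {B : Matrix (Fin n) (Fin r) ℝ} {N M : ℕ} {x y : Fin n → ℝ}
    (hx : x ∈ reachRegion A B N) (hy : y ∈ reachRegion A B M) :
    x + (A ^ N) *ᵥ y ∈ reachRegion A B (N + M) := by
  obtain ⟨z, hz, rfl⟩ := hx
  obtain ⟨w, hw, rfl⟩ := hy
  refine ⟨Fin.append z w, fun k => ?_, ?_⟩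
  · refine Fin.addCases (fun i => ?_) (fun i => ?_) k
    · simpa using hz i
    · simpa using hw i
  · simp [Fin.sum_univ_add, Matrix.mulVec_sum, pow_add, Matrix.mul_assoc]

theorem reachRegion_mono {n r : ℕ} (A : Matrix (Fin n) (Fin n) ℝ)
    (B : Matrix (Fin n) (Fin r) ℝ) : Monotone (reachRegion A B) := by
  intro N M hNM x hx
  obtain ⟨d, rfl⟩ := Nat.exists_eq_add_of_le hNM
  simpa using add_pow_mulVec_mem_reachRegion hx (zero_mem_reachRegion A B d)

theorem ctrbMatrix_mulVec {n r : ℕ} (A : Matrix (Fin n) (Fin n) ℝ)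
    (B : Matrix (Fin n) (Fin r) ℝ) (N : ℕ) (v : Fin N × Fin r → ℝ) :
    ctrbMatrix A B N *ᵥ v =
      ∑ k : Fin N, (A ^ (k : ℕ)) *ᵥ (B *ᵥ fun j => v (k, j)) := by
  ext i
  simp only [Matrix.mulVec_mulVec, Finset.sum_apply]
  simp [ctrbMatrix, Matrix.mulVec, dotProduct, Fintype.sum_prod_type]

theorem zero_mem_interior_reachRegion {n r : ℕ} {A : Matrix (Fin n) (Fin n) ℝ}
    {B : Matrix (Fin n) (Fin r) ℝ} {N : ℕ} (hctrb : (ctrbMatrix A B N).rank = n) :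
    0 ∈ interior (reachRegion A B N) := by
  have hsurj : Function.Surjective (ctrbMatrix A B N).mulVecLin := by
    rw [← LinearMap.range_eq_top]
    apply Submodule.eq_top_of_finrank_eq
    simpa [Matrix.rank] using hctrb
  have hopen := (ctrbMatrix A B N).mulVecLin.isOpenMap_of_finiteDimensional hsurj
  refine mem_interior.2 ⟨_, ?_, hopen _ (Metric.isOpen_ball (x := 0) (ε := 1)),
    0, by simp, by simp⟩
  rintro _ ⟨v, hv, rfl⟩
  refine ⟨fun k j => v (k, j), fun k => ?_, ctrbMatrix_mulVec A B N v⟩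
  rw [pi_norm_le_iff_of_nonneg zero_le_one]
  exact fun j => (norm_le_pi_norm v (k, j)).trans (mem_ball_zero_iff.1 hv).le

theorem reachRegion_subset_interior {n r : ℕ} {A : Matrix (Fin n) (Fin n) ℝ}
    {B : Matrix (Fin n) (Fin r) ℝ} (hA : IsUnit A.det) {M : ℕ}
    (hctrb : (ctrbMatrix A B M).rank = n) (N : ℕ) :
    reachRegion A B N ⊆ interior (reachRegion A B (N + M)) := by
  intro x hx
  have hsurj : Function.Surjective (A ^ N).mulVecLin :=
    Matrix.mulVec_surjective_iff_isUnit.2 (((Matrix.isUnit_iff_isUnit_det A).2 hA).pow N)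
  have hopen := (isOpenMap_add_left x).comp
    ((A ^ N).mulVecLin.isOpenMap_of_finiteDimensional hsurj)
  refine mem_interior.2 ⟨_, ?_, hopen _ isOpen_interior,
    0, zero_mem_interior_reachRegion hctrb, by simp⟩
  rintro _ ⟨y, hy, rfl⟩
  exact add_pow_mulVec_mem_reachRegion hx (interior_subset hy)

/-- If `A` is invertible and the system is controllable (`rank P_n = n`), then for positive
`N₁, N₂` with `N₂ ≥ N₁ + n`, `R(N₁)` is contained in the interior of `R(N₂)`; consequently
the boundaries are disjoint: `∂R(N₁) ∩ ∂R(N₂) = ∅`. -/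
theorem reachRegion_subset_interior_of_controllable {n r : ℕ}
    (A : Matrix (Fin n) (Fin n) ℝ) (B : Matrix (Fin n) (Fin r) ℝ)
    (hA : IsUnit A.det) (hctrb : (ctrbMatrix A B n).rank = n)
    (N₁ N₂ : ℕ) (hN₁ : 0 < N₁) (hN₂ : 0 < N₂) (h : N₁ + n ≤ N₂) :
    reachRegion A B N₁ ⊆ interior (reachRegion A B N₂) ∧
      frontier (reachRegion A B N₁) ∩ frontier (reachRegion A B N₂) = ∅ := by
  have hsub := (reachRegion_subset_interior hA hctrb N₁).trans
    (interior_mono (reachRegion_mono A B h))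
  refine ⟨hsub, Set.disjoint_iff_inter_eq_empty.1 ?_⟩
  exact disjoint_interior_frontier.mono_left
    ((isCompact_reachRegion A B N₁).isClosed.frontier_subset.trans hsub)
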